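/- Let ω and d be positive integers. Let Γ be an abelian group, let A ⊆ Γ be a non-empty set with |Γ \ A| ≤ ω, and let (G, γ) be a Γ-labelled graph. If arb_{(Γ,A)}(G, γ) ≥ (ω + 2) · 2^{d(ω+1)+1}, then G contains an (A, d)-cycle. -/

import Mathlib

namespace ArbPaper

universe u v

/-- The `γ`-value of a walk: the sum of the labels of its edges. -/
def walkVal {V : Type u} {Γ : Type v} [AddCommGroup Γ] {G : SimpleGraph V}
    (γ : Sym2 V → Γ) {x y : V} (w : G.Walk x y) : Γ :=
  (w.edges.map γ).sum

/-- The set `S` induces a subgraph having no cycle of `γ`-value in `A`. -/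
def NoCycleValIn {V : Type u} {Γ : Type v} [AddCommGroup Γ] (G : SimpleGraph V)
    (γ : Sym2 V → Γ) (A : Set Γ) (S : Set V) : Prop :=
  ∀ (v : V) (w : G.Walk v v), w.IsCycle → (∀ x ∈ w.support, x ∈ S) →
    walkVal γ w ∉ A

/-- The `(Γ, A)`-vertex-arboricity of the subgraph of `G` induced on `S`:
the minimum number of parts in a partition of `S` such that each part induces
a subgraph having no cycle of `γ`-value in `A`. -/
noncomputable def arbOn {V : Type u} {Γ : Type v} [AddCommGroup Γ] (G : SimpleGraph V)
    (γ : Sym2 V → Γ) (A : Set Γ) (S : Set V) : ℕ :=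
  sInf {k : ℕ | ∃ f : V → Fin k,
    ∀ i : Fin k, NoCycleValIn G γ A {v | v ∈ S ∧ f v = i}}

/-- The `(Γ, A)`-vertex-arboricity of `(G, γ)`. -/
noncomputable def arb {V : Type u} {Γ : Type v} [AddCommGroup Γ] (G : SimpleGraph V)
    (γ : Sym2 V → Γ) (A : Set Γ) : ℕ :=
  arbOn G γ A Set.univ

/-- `G` contains an `(A, d)`-cycle: a cycle of `γ`-value in `A` and length at least `d`. -/
def ContainsADCycle {V : Type u} {Γ : Type v} [AddCommGroup Γ] (G : SimpleGraph V)
    (γ : Sym2 V → Γ) (A : Set Γ) (d : ℕ) : Prop :=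
  ∃ (v : V) (w : G.Walk v v), w.IsCycle ∧ walkVal γ w ∈ A ∧ d ≤ w.length

/-- `b` (the branching vertices) together with the branching paths `P i j` (for `i < j`)
form a subdivision of the complete graph `K t` inside `G`. -/
def IsKtSubdivision {V : Type u} (G : SimpleGraph V) (t : ℕ) (b : Fin t → V)
    (P : ∀ i j : Fin t, G.Walk (b i) (b j)) : Prop :=
  Function.Injective b ∧
  (∀ i j : Fin t, i < j → (P i j).IsPath) ∧
  (∀ i j : Fin t, i < j → ∀ v ∈ (P i j).support, v ∈ Set.range b → v = b i ∨ v = b j) ∧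
  (∀ i j k l : Fin t, i < j → k < l → (i, j) ≠ (k, l) → ∀ v,
    v ∈ (P i j).support → v ∈ (P k l).support →
      (v = b i ∨ v = b j) ∧ (v = b k ∨ v = b l))

/-- `G` itself is (as a whole) a subdivision of `K t` with data `b`, `P`:
every vertex and every edge of `G` lies on some branching path. -/
def IsSpanningKtSubdivision {V : Type u} (G : SimpleGraph V) (t : ℕ) (b : Fin t → V)
    (P : ∀ i j : Fin t, G.Walk (b i) (b j)) : Prop :=
  IsKtSubdivision G t b P ∧
  (∀ v : V, ∃ i j : Fin t, i < j ∧ v ∈ (P i j).support) ∧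
  (∀ e ∈ G.edgeSet, ∃ i j : Fin t, i < j ∧ e ∈ (P i j).edges)

/-- `G` contains an `(A, d)`-subdivision of `K t`: a subdivision of `K t` in which every
branching path has `γ`-value in `A` and length at least `d`. -/
def ContainsADSubdivision {V : Type u} {Γ : Type v} [AddCommGroup Γ] (G : SimpleGraph V)
    (γ : Sym2 V → Γ) (A : Set Γ) (t d : ℕ) : Prop :=
  ∃ (b : Fin t → V) (P : ∀ i j : Fin t, G.Walk (b i) (b j)),
    IsKtSubdivision G t b P ∧
    ∀ i j : Fin t, i < j → walkVal γ (P i j) ∈ A ∧ d ≤ (P i j).length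

/-- `w` is an `X`-path lying inside the induced subgraph `G[Y]`: a path of length at
least `2` whose endpoints lie in `X`, internal vertices lie outside `X`, and all of
whose vertices lie in `Y`. -/
def IsXPathIn {V : Type u} (G : SimpleGraph V) (X Y : Set V) {x y : V}
    (w : G.Walk x y) : Prop :=
  w.IsPath ∧ 2 ≤ w.length ∧ x ∈ X ∧ y ∈ X ∧
  (∀ v ∈ w.support, v ∈ Y) ∧
  (∀ v ∈ w.support, v ≠ x → v ≠ y → v ∉ X)

/-- `(L 0, L 1, …, L p)` is a leveling of the connected graph `G`. -/
def IsLeveling {V : Type u} (G : SimpleGraph V) (p : ℕ) (L : ℕ → Set V) : Prop :=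
  (∀ i j, i ≤ p → j ≤ p → i ≠ j → Disjoint (L i) (L j)) ∧
  (∃ v : V, L 0 = {v}) ∧
  (∀ v : V, ∃ i, i ≤ p ∧ v ∈ L i) ∧
  (∀ i, 1 ≤ i → i ≤ p → ∀ v ∈ L i,
    (∃ u ∈ L (i - 1), G.Adj v u) ∧ (∀ j, j + 2 ≤ i → ∀ u ∈ L j, ¬ G.Adj v u))

/-- `G[Y]` is a connected component of `G[S]`. -/
def IsCompOf {V : Type u} (G : SimpleGraph V) (Y S : Set V) : Prop :=
  Y ⊆ S ∧ (G.induce Y).Connected ∧ ∀ u ∈ Y, ∀ v ∈ S, G.Adj u v → v ∈ Y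



open SimpleGraph

section Basics

variable {V : Type u} {Γ : Type v} [AddCommGroup Γ] {G : SimpleGraph V} {γ : Sym2 V → Γ}

lemma walkVal_nil (x : V) : walkVal γ (Walk.nil : G.Walk x x) = 0 := by
  simp [walkVal]

lemma walkVal_cons {x y z : V} (h : G.Adj x y) (p : G.Walk y z) :
    walkVal γ (Walk.cons h p) = γ s(x, y) + walkVal γ p := by
  simp [walkVal]

lemma walkVal_append {x y z : V} (p : G.Walk x y) (q : G.Walk y z) :
    walkVal γ (p.append q) = walkVal γ p + walkVal γ q := by
  simp [walkVal]

/-- There is a path from `z` to `y` inside `T` of value `a` and length at least `l`. -/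
def Reach (G : SimpleGraph V) (γ : Sym2 V → Γ) (T : Set V) (z y : V) (a : Γ) (l : ℕ) : Prop :=
  ∃ p : G.Walk z y, p.IsPath ∧ (∀ v ∈ p.support, v ∈ T) ∧ walkVal γ p = a ∧ l ≤ p.length

/-- `T` induces a connected (or empty) subgraph. -/
def Conn (G : SimpleGraph V) (T : Set V) : Prop :=
  ∀ u ∈ T, ∀ v ∈ T, ∃ p : G.Walk u v, p.IsPath ∧ ∀ x ∈ p.support, x ∈ T

lemma exists_path_of_walk {T : Set V} {u v : V} (p : G.Walk u v) (hp : ∀ x ∈ p.support, x ∈ T) :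
    ∃ p : G.Walk u v, p.IsPath ∧ ∀ x ∈ p.support, x ∈ T := by
  classical
  exact ⟨p.bypass, p.bypass_isPath, fun x hx => hp x (p.support_bypass_subset_support hx)⟩

lemma isPath_append {x y z : V} {p : G.Walk x y} {q : G.Walk y z} (hp : p.IsPath) (hq : q.IsPath)
    (h : ∀ v, v ∈ p.support → v ∈ q.support → v = y) : (p.append q).IsPath := by
  rw [Walk.isPath_def, Walk.support_append]
  rw [Walk.isPath_def] at hp hq
  have hq' := hq
  rw [← Walk.cons_tail_support] at hq'
  rw [List.nodup_cons] at hq'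
  rw [List.nodup_append']
  refine ⟨hp, hq'.2, ?_⟩
  intro v hv hv'
  have := h v hv (List.mem_of_mem_tail hv')
  subst this
  exact hq'.1 hv'

lemma Reach.append {S T : Set V} {x y z : V} {a b : Γ} {l m : ℕ} (h : Reach G γ S x y a l)
    (h' : Reach G γ T y z b m) (hd : ∀ v ∈ S, v ∈ T → v = y) :
    Reach G γ (S ∪ T) x z (a + b) (l + m) := by
  obtain ⟨p, hp, hpS, hpa, hpl⟩ := h
  obtain ⟨q, hq, hqS, hqa, hql⟩ := h'
  refine ⟨p.append q, isPath_append hp hq (fun v hv hv' => hd v (hpS v hv) (hqS v hv')), ?_, ?_, ?_⟩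
  · intro v hv
    rw [Walk.mem_support_append_iff] at hv
    rcases hv with hv | hv
    · exact Or.inl (hpS v hv)
    · exact Or.inr (hqS v hv)
  · rw [walkVal_append, hpa, hqa]
  · rw [Walk.length_append]; omega

lemma Reach.mono {S T : Set V} {x y : V} {a : Γ} {l m : ℕ} (h : Reach G γ S x y a l)
    (hST : S ⊆ T) (hm : m ≤ l) : Reach G γ T x y a m := by
  obtain ⟨p, hp, hpS, hpa, hpl⟩ := h
  exact ⟨p, hp, fun v hv => hST (hpS v hv), hpa, hm.trans hpl⟩

lemma Reach.refl {T : Set V} {x : V} (hx : x ∈ T) : Reach G γ T x x 0 0 := by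
  refine ⟨Walk.nil, by simp, ?_, walkVal_nil x, by simp⟩
  simpa using hx

lemma Reach.edge {T : Set V} {x y : V} (h : G.Adj x y) (hx : x ∈ T) (hy : y ∈ T) :
    Reach G γ T x y (γ s(x, y)) 1 := by
  refine ⟨Walk.cons h Walk.nil, ?_, ?_, ?_, by simp⟩
  · simp [Walk.cons_isPath_iff, h.ne]
  · intro v hv
    simp at hv
    rcases hv with rfl | rfl <;> assumption
  · simp [walkVal]

lemma Conn.reach {T : Set V} (h : Conn G T) {x y : V} (hx : x ∈ T) (hy : y ∈ T) :
    ∃ a, Reach G γ T x y a 0 := by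
  obtain ⟨p, hp, hpT⟩ := h x hx y hy
  exact ⟨_, p, hp, hpT, rfl, by simp⟩

/-- Closing up a path in `X` through a connected set `U` to which all of `X` attaches. -/
lemma close_cycle {U X : Set V} (hUX : Disjoint U X) (hU : Conn G U)
    (hN : ∀ x ∈ X, ∃ u ∈ U, G.Adj x u) {x y : V} (hx : x ∈ X) (hy : y ∈ X) (hxy : x ≠ y) :
    ∃ c : Γ, ∀ (p : G.Walk x y), p.IsPath → (∀ v ∈ p.support, v ∈ X) →
      ∃ w : G.Walk y y, w.IsCycle ∧ (∀ v ∈ w.support, v ∈ U ∪ X) ∧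
        walkVal γ w = c + walkVal γ p ∧ p.length ≤ w.length := by
  obtain ⟨u, hu, hxu⟩ := hN x hx
  obtain ⟨v, hv, hyv⟩ := hN y hy
  obtain ⟨q, hq, hqU⟩ := hU v hv u hu
  have hdis : ∀ t, t ∈ U → t ∈ X → False := fun t h1 h2 => Set.disjoint_left.mp hUX h1 h2
  refine ⟨γ s(y, v) + walkVal γ q + γ s(u, x), fun p hp hpX => ?_⟩
  have h1 : (Walk.cons hxu.symm p).IsPath := by
    rw [Walk.cons_isPath_iff]
    exact ⟨hp, fun h => hdis u hu (hpX u h)⟩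
  have h2 : (q.append (Walk.cons hxu.symm p)).IsPath := by
    apply isPath_append hq h1
    intro t ht ht'
    rw [Walk.support_cons, List.mem_cons] at ht'
    rcases ht' with h | h
    · exact h
    · exact (hdis t (hqU t ht) (hpX t h)).elim
  refine ⟨Walk.cons hyv (q.append (Walk.cons hxu.symm p)), ?_, ?_, ?_, ?_⟩
  · rw [Walk.cons_isCycle_iff]
    refine ⟨h2, ?_⟩
    intro he
    rw [Walk.edges_append, List.mem_append, Walk.edges_cons, List.mem_cons] at he
    rcases he with he | he | he
    · exact hdis y (hqU y (Walk.fst_mem_support_of_mem_edges _ he)) hy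
    · rw [Sym2.eq_iff] at he
      rcases he with ⟨rfl, rfl⟩ | ⟨rfl, rfl⟩
      · exact hdis _ hu hy
      · exact hxy rfl
    · exact hdis v hv (hpX v (Walk.snd_mem_support_of_mem_edges _ he))
  · intro t ht
    rw [Walk.support_cons, List.mem_cons, Walk.mem_support_append_iff, Walk.support_cons,
      List.mem_cons] at ht
    rcases ht with rfl | ht | rfl | ht
    · exact Or.inr hy
    · exact Or.inl (hqU t ht)
    · exact Or.inl hu
    · exact Or.inr (hpX t ht)
  · rw [walkVal_cons, walkVal_append, walkVal_cons]; abel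
  · simp; omega

/-- First hitting of `X` along a walk. -/
lemma first_hit {R X : Set V} {z x : V} (p : G.Walk z x) (hp : ∀ v ∈ p.support, v ∈ R)
    (hx : x ∈ X) : ∃ y ∈ X, ∃ q : G.Walk z y, ∀ v ∈ q.support, v ∈ (R \ X) ∪ {y} := by
  induction p with
  | nil => exact ⟨_, hx, Walk.nil, by simp⟩
  | @cons a b c h p ih =>
    by_cases ha : a ∈ X
    · exact ⟨a, ha, Walk.nil, by simp⟩
    · obtain ⟨y, hy, q, hq⟩ := ih (fun v hv => hp v (by simp [hv])) hx
      refine ⟨y, hy, Walk.cons h q, ?_⟩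
      intro v hv
      rw [Walk.support_cons, List.mem_cons] at hv
      rcases hv with rfl | hv
      · exact Or.inl ⟨hp _ (by simp), ha⟩
      · exact hq v hv

/-- `S` can be coloured with `k` colours avoiding monochromatic cycles of value in `A`. -/
def Col (G : SimpleGraph V) (γ : Sym2 V → Γ) (A : Set Γ) (k : ℕ) (S : Set V) : Prop :=
  ∃ f : V → ℕ, (∀ v ∈ S, f v < k) ∧ ∀ i, NoCycleValIn G γ A {v | v ∈ S ∧ f v = i}

variable {A : Set Γ}

lemma Col.mono {k m : ℕ} {S : Set V} (h : Col G γ A k S) (hkm : k ≤ m) : Col G γ A m S := by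
  obtain ⟨f, hf, hc⟩ := h
  exact ⟨f, fun v hv => (hf v hv).trans_le hkm, hc⟩

lemma NoCycleValIn.mono {S T : Set V} (h : NoCycleValIn G γ A T) (hST : S ⊆ T) :
    NoCycleValIn G γ A S := fun v w hw hS => h v w hw (fun x hx => hST (hS x hx))

lemma cycle_not_singleton {v : V} {w : G.Walk v v} (hw : w.IsCycle) (x : V)
    (h : ∀ t ∈ w.support, t = x) : False := by
  cases w with
  | nil => exact hw.ne_nil rfl
  | cons h' p =>
    have h1 := h v (by simp)
    have h2 := h _ (show _ ∈ (Walk.cons h' p).support by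
      rw [Walk.support_cons]; exact List.mem_cons_of_mem _ p.start_mem_support)
    exact h'.ne (h1.trans h2.symm)

lemma noCycle_singleton (x : V) : NoCycleValIn G γ A {v | v = x} := by
  intro v w hw h
  exact (cycle_not_singleton hw x h).elim

lemma Col.empty (k : ℕ) : Col G γ A k (∅ : Set V) := by
  refine ⟨fun _ => 0, by simp, ?_⟩
  intro i v w hw h
  have := h v w.start_mem_support
  simp at this

lemma Col.insert {k : ℕ} {S : Set V} (x : V) (h : Col G γ A k (S \ {x})) :
    Col G γ A (k + 1) S := by
  classical
  obtain ⟨f, hf, hc⟩ := h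
  refine ⟨fun v => if v = x then k else f v, ?_, ?_⟩
  · intro v hv
    by_cases h : v = x
    · simp [h]
    · have := hf v ⟨hv, h⟩
      simp [h]; omega
  · intro i
    by_cases hi : i = k
    · apply (noCycle_singleton x).mono
      rintro v ⟨hv, hvi⟩
      by_contra h
      have h : v ≠ x := h
      have := hf v ⟨hv, h⟩
      simp [h] at hvi
      omega
    · apply (hc i).mono
      rintro v ⟨hv, hvi⟩
      by_cases h : v = x
      · simp [h] at hvi; omega
      · simp [h] at hvi
        exact ⟨⟨hv, h⟩, hvi⟩

/-- Along a walk whose adjacent vertices share a value, the value is constant. -/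
lemma walk_const {α : Type*} {S : Set V} (f : V → α)
    (hf : ∀ u ∈ S, ∀ v ∈ S, G.Adj u v → f u = f v) {x y : V} (w : G.Walk x y)
    (hw : ∀ v ∈ w.support, v ∈ S) : ∀ v ∈ w.support, f v = f x := by
  induction w with
  | nil => intro v hv; simp at hv; rw [hv]
  | @cons a b c h p ih =>
    have hp : ∀ v ∈ p.support, v ∈ S := fun v hv => hw v (by simp [hv])
    intro v hv
    rw [Walk.support_cons, List.mem_cons] at hv
    rcases hv with rfl | hv
    · rfl
    · rw [ih hp v hv]
      exact (hf a (hw a (by simp)) b (hp b p.start_mem_support) h).symm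

lemma glue {k : ℕ} {S T : Set V} (f g : V → ℕ) (hfg : ∀ v ∈ S, v ∈ T → f v = g v)
    (hf : ∀ v ∈ S, f v < k) (hg : ∀ v ∈ T, g v < k)
    (hcf : ∀ i, NoCycleValIn G γ A {v | v ∈ S ∧ f v = i})
    (hcg : ∀ i, NoCycleValIn G γ A {v | v ∈ T ∧ g v = i})
    (hcyc : ∀ (v : V) (w : G.Walk v v), w.IsCycle → (∀ x ∈ w.support, x ∈ S ∪ T) →
      (∀ x ∈ w.support, x ∈ S) ∨ (∀ x ∈ w.support, x ∈ T)) : Col G γ A k (S ∪ T) := by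
  classical
  have e1 : ∀ v ∈ S, (if v ∈ S then f v else g v) = f v := fun v hv => by simp [hv]
  have e2 : ∀ v ∈ T, (if v ∈ S then f v else g v) = g v := fun v hv => by
    by_cases h : v ∈ S
    · simp [h, hfg v h hv]
    · simp [h]
  refine ⟨fun v => if v ∈ S then f v else g v, ?_, ?_⟩
  · rintro v (hv | hv)
    · exact (e1 v hv).trans_lt (hf v hv)
    · exact (e2 v hv).trans_lt (hg v hv)
  · intro i v w hw hS
    rcases hcyc v w hw (fun x hx => (hS x hx).1) with h | h
    · exact hcf i v w hw (fun x hx => ⟨h x hx, (e1 x (h x hx)).symm.trans (hS x hx).2⟩)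
    · exact hcg i v w hw (fun x hx => ⟨h x hx, (e2 x (h x hx)).symm.trans (hS x hx).2⟩)

/-- Gluing two disjoint sets with no edges between. -/
lemma glue_disjoint {k : ℕ} {S T : Set V} (hd : ∀ v ∈ S, v ∉ T)
    (hE : ∀ u ∈ S, ∀ v ∈ T, ¬ G.Adj u v) (hS : Col G γ A k S) (hT : Col G γ A k T) :
    Col G γ A k (S ∪ T) := by
  obtain ⟨f, hf, hcf⟩ := hS
  obtain ⟨g, hg, hcg⟩ := hT
  refine glue f g (fun v h h' => (hd v h h').elim) hf hg hcf hcg ?_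
  intro v w hw hwS
  have hc := walk_const (S := S ∪ T) (fun v => (v ∈ S : Prop)) (by
    rintro a ha b hb hab
    apply propext
    rcases ha with ha | ha <;> rcases hb with hb | hb
    · simp [ha, hb]
    · exact (hE a ha b hb hab).elim
    · exact (hE b hb a ha hab.symm).elim
    · exact ⟨fun h => (hd a h ha).elim, fun h => (hd b h hb).elim⟩) w hwS
  by_cases hv : v ∈ S
  · left; intro x hx
    have := hc x hx
    simpa [hv] using this
  · right; intro x hx
    have h1 := hc x hx
    rcases hwS x hx with h | h
    · simp [hv] at h1; exact (h1 h).elim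
    · exact h

lemma path_to_cut {S T : Set V} {x : V} (hSx : x ∉ S)
    (hE : ∀ u ∈ S, ∀ v ∈ T, ¬ G.Adj u v) {a b : V} (p : G.Walk a b) (hb : b = x) (hp : p.IsPath)
    (hpS : ∀ v ∈ p.support, v ∈ S ∨ v ∈ T ∨ v = x) (ha : a ∈ S) :
    ∀ v ∈ p.support, v ∈ S ∨ v = x := by
  induction p with
  | nil => exact (hSx (hb ▸ ha)).elim
  | @cons a c b h p ih =>
    rw [Walk.cons_isPath_iff] at hp
    have hc := hpS c (by simp)
    intro v hv
    rw [Walk.support_cons, List.mem_cons] at hv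
    rcases hv with rfl | hv
    · exact Or.inl ha
    rcases hc with hc | hc | hc
    · exact ih hb hp.1 (fun v hv => hpS v (by simp [hv])) hc v hv
    · exact (hE a ha c hc h).elim
    · subst hc
      subst hb
      have := Walk.isPath_iff_nil.mp hp.1
      have h2 : p = Walk.nil := by simpa using this
      rw [h2] at hv
      simp at hv
      exact Or.inr hv

/-- Gluing at a cut vertex. -/
lemma glue_cut {k : ℕ} {S T : Set V} {x : V} (hSx : x ∉ S) (hTx : x ∉ T) (hd : ∀ v ∈ S, v ∉ T)
    (hE : ∀ u ∈ S, ∀ v ∈ T, ¬ G.Adj u v) (hS : Col G γ A k (S ∪ {x}))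
    (hT : Col G γ A k (T ∪ {x})) : Col G γ A k ((S ∪ {x}) ∪ (T ∪ {x})) := by
  classical
  obtain ⟨f, hf, hcf⟩ := hS
  obtain ⟨g, hg, hcg⟩ := hT
  have hfx := hf x (by simp)
  have hgx := hg x (by simp)
  have hE' : ∀ u ∈ T, ∀ v ∈ S, ¬ G.Adj u v := fun u hu v hv h => hE v hv u hu h.symm
  refine glue f (fun v => Equiv.swap (f x) (g x) (g v)) ?_ hf ?_ hcf ?_ ?_
  · rintro v (hv | hv) (hv' | hv')
    · exact (hd v hv hv').elim
    · exact (hSx (hv' ▸ hv)).elim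
    · exact (hTx (hv ▸ hv')).elim
    · have : v = x := hv
      subst this
      simp
  · intro v hv
    have := hg v hv
    simp only [Equiv.swap_apply_def]
    split_ifs <;> assumption
  · intro i
    apply (hcg (Equiv.swap (f x) (g x) i)).mono
    rintro v ⟨hv, hvi⟩
    refine ⟨hv, ?_⟩
    have hvi' : Equiv.swap (f x) (g x) (g v) = i := hvi
    rw [← hvi', Equiv.swap_apply_self]
  · intro v w hw hwS
    have hwS' : ∀ y ∈ w.support, y ∈ S ∨ y ∈ T ∨ y = x := by
      intro y hy
      rcases hwS y hy with (h | h) | (h | h)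
      · exact Or.inl h
      · exact Or.inr (Or.inr h)
      · exact Or.inr (Or.inl h)
      · exact Or.inr (Or.inr h)
    by_cases hx : x ∈ w.support
    · have hrot : (w.rotate x hx).IsCycle := (Walk.isCycle_rotate hx).mpr hw
      have hmem : ∀ y, y ∈ w.support ↔ y ∈ (w.rotate x hx).support := fun y =>
        (Walk.mem_support_rotate_iff w x hx).symm
      have key : ∀ (w' : G.Walk x x), w'.IsCycle → (∀ y ∈ w'.support, y ∈ S ∨ y ∈ T ∨ y = x) →
          (∀ y ∈ w'.support, y ∈ S ∪ {x}) ∨ (∀ y ∈ w'.support, y ∈ T ∪ {x}) := by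
        intro w' hw' hs
        cases w' with
        | nil => exact (hw'.ne_nil rfl).elim
        | @cons _ c _ h p =>
          rw [Walk.cons_isCycle_iff] at hw'
          have hs' : ∀ y ∈ p.support, y ∈ S ∨ y ∈ T ∨ y = x := fun y hy => hs y (by simp [hy])
          rcases hs c (by simp) with hc | hc | hc
          · left
            intro y hy
            rw [Walk.support_cons, List.mem_cons] at hy
            rcases hy with rfl | hy
            · exact Or.inr rfl
            · exact path_to_cut hSx hE p rfl hw'.1 hs' hc y hy
          · right
            intro y hy
            rw [Walk.support_cons, List.mem_cons] at hy
            rcases hy with rfl | hy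
            · exact Or.inr rfl
            · exact path_to_cut hTx hE' p rfl hw'.1 (fun y hy => by
                rcases hs' y hy with h | h | h
                · exact Or.inr (Or.inl h)
                · exact Or.inl h
                · exact Or.inr (Or.inr h)) hc y hy
          · exact (h.ne hc.symm).elim
      rcases key _ hrot (fun y hy => hwS' y ((hmem y).mpr hy)) with h | h
      · exact Or.inl fun y hy => h y ((hmem y).mp hy)
      · exact Or.inr fun y hy => h y ((hmem y).mp hy)
    · have hST : ∀ y ∈ w.support, y ∈ S ∪ T := by
        intro y hy
        rcases hwS' y hy with h | h | h
        · exact Or.inl h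
        · exact Or.inr h
        · exact (hx (h ▸ hy)).elim
      have hc := walk_const (S := S ∪ T) (fun v => (v ∈ S : Prop)) (by
        rintro a ha b hb hab
        apply propext
        rcases ha with ha | ha <;> rcases hb with hb | hb
        · simp [ha, hb]
        · exact (hE a ha b hb hab).elim
        · exact (hE b hb a ha hab.symm).elim
        · exact ⟨fun h => (hd a h ha).elim, fun h => (hd b h hb).elim⟩) w hST
      by_cases hv : v ∈ S
      · left; intro y hy
        have := hc y hy
        left
        simpa [hv] using this
      · right; intro y hy
        have h1 := hc y hy
        rcases hST y hy with h | h
        · simp [hv] at h1; exact (h1 h).elim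
        · exact Or.inl h

/-- If a set is not connected it splits in two nonempty parts. -/
lemma split_of_not_conn {T : Set V} (h : ¬ Conn G T) : ∃ S S' : Set V, S ∪ S' = T ∧
    S.Nonempty ∧ S'.Nonempty ∧ (∀ v ∈ S, v ∉ S') ∧ ∀ u ∈ S, ∀ v ∈ S', ¬ G.Adj u v := by
  unfold Conn at h
  push Not at h
  obtain ⟨u, hu, v, hv, hno⟩ := h
  refine ⟨{x | x ∈ T ∧ ∃ p : G.Walk u x, ∀ y ∈ p.support, y ∈ T},
    {x | x ∈ T ∧ ¬ ∃ p : G.Walk u x, ∀ y ∈ p.support, y ∈ T}, ?_, ⟨u, hu, Walk.nil, by simpa⟩,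
    ⟨v, hv, ?_⟩, ?_, ?_⟩
  · ext x
    simp only [Set.mem_union, Set.mem_ofPred_eq]
    tauto
  · rintro ⟨p, hp⟩
    obtain ⟨q, hq, hqT⟩ := exists_path_of_walk p hp
    obtain ⟨x, hx, hxT⟩ := hno q hq
    exact hxT (hqT x hx)
  · rintro x ⟨_, hx⟩ ⟨_, hx'⟩
    exact hx' hx
  · rintro a ⟨ha, p, hp⟩ b ⟨hb, hb'⟩ hab
    apply hb'
    refine ⟨p.concat hab, ?_⟩
    intro y hy
    rw [Walk.support_concat, List.mem_append] at hy
    rcases hy with hy | hy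
    · exact hp y hy
    · simp at hy; rw [hy]; exact hb

/-- Vertex-critical for `k`-colourability. -/
def Crit (G : SimpleGraph V) (γ : Sym2 V → Γ) (A : Set Γ) (k : ℕ) (X : Set V) : Prop :=
  ¬ Col G γ A k X ∧ ∀ Y, Y ⊆ X → Y ≠ X → Col G γ A k Y

lemma exists_crit [Finite V] {k : ℕ} {S : Set V} (h : ¬ Col G γ A k S) :
    ∃ X, X ⊆ S ∧ Crit G γ A k X := by
  obtain ⟨X, hX, hmin⟩ := exists_minimal_le_of_wellFoundedLT (fun X => ¬ Col G γ A k X) S h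
  refine ⟨X, hX, hmin.prop, fun Y hY hne => ?_⟩
  by_contra hc
  exact hne (Set.Subset.antisymm hY (hmin.le_of_le hc hY))

lemma Crit.nonempty {k : ℕ} {X : Set V} (h : Crit G γ A k X) : X.Nonempty := by
  by_contra hne
  rw [Set.not_nonempty_iff_eq_empty] at hne
  exact h.1 (hne ▸ Col.empty k)

lemma Crit.conn {k : ℕ} {X : Set V} (h : Crit G γ A k X) : Conn G X := by
  by_contra hc
  obtain ⟨S, S', hU, ⟨s, hs⟩, ⟨s', hs'⟩, hd, hE⟩ := split_of_not_conn hc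
  apply h.1
  rw [← hU]
  apply glue_disjoint hd hE
  · apply h.2 _ (hU ▸ Set.subset_union_left)
    intro he
    exact hd s' (by rw [he, ← hU]; exact Or.inr hs') hs'
  · apply h.2 _ (hU ▸ Set.subset_union_right)
    intro he
    exact hd s hs (by rw [he, ← hU]; exact Or.inl hs)

lemma Crit.conn_diff {k : ℕ} {X : Set V} (h : Crit G γ A k X) (x : V) (hx : x ∈ X) :
    Conn G (X \ {x}) := by
  by_contra hc
  obtain ⟨S, S', hU, ⟨s, hs⟩, ⟨s', hs'⟩, hd, hE⟩ := split_of_not_conn hc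
  have hSX : ∀ y ∈ S, y ∈ X ∧ y ≠ x := fun y hy => by
    have : y ∈ X \ {x} := hU ▸ Or.inl hy
    exact this
  have hSX' : ∀ y ∈ S', y ∈ X ∧ y ≠ x := fun y hy => by
    have : y ∈ X \ {x} := hU ▸ Or.inr hy
    exact this
  have hXe : (S ∪ {x}) ∪ (S' ∪ {x}) = X := by
    ext y
    constructor
    · rintro ((hy | hy) | (hy | hy))
      · exact (hSX y hy).1
      · exact hy ▸ hx
      · exact (hSX' y hy).1
      · exact hy ▸ hx
    · intro hy
      by_cases hyx : y = x
      · exact Or.inl (Or.inr hyx)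
      · have : y ∈ S ∪ S' := hU ▸ ⟨hy, hyx⟩
        rcases this with h | h
        · exact Or.inl (Or.inl h)
        · exact Or.inr (Or.inl h)
  apply h.1
  have hres : Col G γ A k ((S ∪ {x}) ∪ (S' ∪ {x})) := by
    apply glue_cut (fun h => (hSX x h).2 rfl) (fun h => (hSX' x h).2 rfl) hd hE
    · apply h.2 _ (by rw [← hXe]; exact Set.subset_union_left)
      intro he
      have : s' ∈ S ∪ {x} := he ▸ (hSX' s' hs').1
      rcases this with h | h
      · exact hd s' h hs'
      · exact (hSX' s' hs').2 h
    · apply h.2 _ (by rw [← hXe]; exact Set.subset_union_right)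
      intro he
      have : s ∈ S' ∪ {x} := he ▸ (hSX s hs).1
      rcases this with h | h
      · exact hd s hs h
      · exact (hSX s hs).2 h
  rwa [hXe] at hres

end Basics

section Levels

variable {V : Type u} {Γ : Type v} [AddCommGroup Γ] {G : SimpleGraph V} {γ : Sym2 V → Γ}
  {A : Set Γ}

/-- Breadth-first level function inside `R`. -/
lemma exists_level {R : Set V} {z : V} (hR : Conn G R) (hz : z ∈ R) :
    ∃ lev : V → ℕ, (∀ v ∈ R, lev v = 0 → v = z) ∧ lev z = 0 ∧
      (∀ a ∈ R, ∀ b ∈ R, G.Adj a b → lev a ≤ lev b + 1) ∧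
      (∀ v ∈ R, ∀ m, lev v = m + 1 → ∃ u ∈ R, G.Adj v u ∧ lev u = m) := by
  classical
  let D : V → Set ℕ := fun v => {n | ∃ w : G.Walk v z, (∀ x ∈ w.support, x ∈ R) ∧ w.length = n}
  have hmem : ∀ v ∈ R, sInf (D v) ∈ D v := by
    intro v hv
    apply Nat.sInf_mem
    obtain ⟨p, _, hp⟩ := hR v hv z hz
    exact ⟨p.length, p, hp, rfl⟩
  have hle : ∀ v (w : G.Walk v z), (∀ x ∈ w.support, x ∈ R) → sInf (D v) ≤ w.length :=
    fun v w hw => Nat.sInf_le ⟨w, hw, rfl⟩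
  have hadj : ∀ a ∈ R, ∀ b ∈ R, G.Adj a b → sInf (D a) ≤ sInf (D b) + 1 := by
    intro a ha b hb hab
    obtain ⟨w, hw, hwl⟩ := hmem b hb
    have := hle a (Walk.cons hab w) (by
      intro x hx
      rw [Walk.support_cons, List.mem_cons] at hx
      rcases hx with rfl | hx
      · exact ha
      · exact hw x hx)
    rw [Walk.length_cons, hwl] at this
    exact this
  refine ⟨fun v => sInf (D v), ?_, ?_, hadj, ?_⟩
  · intro v hv h0
    obtain ⟨w, hw, hwl⟩ := hmem v hv
    exact Walk.eq_of_length_eq_zero (hwl.trans h0)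
  · have := hle z Walk.nil (by simpa using hz)
    simpa using this
  · intro v hv m hm
    obtain ⟨w, hw, hwl⟩ := hmem v hv
    have hwl' : w.length = m + 1 := hwl.trans hm
    cases w with
    | nil => simp at hwl'
    | @cons _ u _ h p =>
      have hp : ∀ x ∈ p.support, x ∈ R := fun x hx => hw x (by simp [hx])
      have hu : u ∈ R := hp u p.start_mem_support
      refine ⟨u, hu, h, ?_⟩
      have h1 := hle u p hp
      have h2 := hadj v hv u hu h
      rw [Walk.length_cons] at hwl'
      simp only at hm
      show sInf (D u) = m
      omega

lemma halve [Finite V] {R : Set V} {z : V} (hR : Conn G R) (hz : z ∈ R) {k : ℕ} (hk : 1 ≤ k)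
    (h : ¬ Col G γ A (2 * k) R) : ∃ U X : Set V, U ⊆ R ∧ X ⊆ R ∧ Disjoint U X ∧ z ∈ U ∧
      Conn G U ∧ (∀ x ∈ X, ∃ u ∈ U, G.Adj x u) ∧ Crit G γ A k X := by
  classical
  obtain ⟨lev, h0, hz0, hadj, hpred⟩ := exists_level hR hz
  obtain ⟨p, hp⟩ : ∃ p, ¬ Col G γ A k {v | v ∈ R ∧ lev v = p} := by
    by_contra hc
    push Not at hc
    choose f hf hfc using hc
    apply h
    refine ⟨fun v => f (lev v) v + k * (lev v % 2), ?_, ?_⟩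
    · intro v hv
      have := hf (lev v) v ⟨hv, rfl⟩
      rcases Nat.mod_two_eq_zero_or_one (lev v) with h | h <;> simp [h] <;> omega
    · intro i v w hw hS
      have key : ∀ a ∈ R, f (lev a) a + k * (lev a % 2) = i →
          lev a % 2 = i / k ∧ f (lev a) a = i % k := by
        intro a ha hi
        have := hf (lev a) a ⟨ha, rfl⟩
        constructor
        · rw [← hi, Nat.add_mul_div_left _ _ (by omega), Nat.div_eq_of_lt this, zero_add]
        · rw [← hi, Nat.add_mul_mod_self_left, Nat.mod_eq_of_lt this]
      have hc := walk_const (S := {v | v ∈ R ∧ f (lev v) v + k * (lev v % 2) = i}) lev (by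
        rintro a ⟨ha, hai⟩ b ⟨hb, hbi⟩ hab
        have h1 := hadj a ha b hb hab
        have h2 := hadj b hb a ha hab.symm
        have h3 := (key a ha hai).1
        have h4 := (key b hb hbi).1
        omega) w hS
      refine hfc (lev v) (i % k) v w hw ?_
      intro x hx
      have h1 := hS x hx
      have h2 := hc x hx
      refine ⟨⟨h1.1, h2⟩, ?_⟩
      rw [← h2]
      exact (key x h1.1 h1.2).2
  have hp1 : p ≠ 0 := by
    rintro rfl
    apply hp
    refine ⟨fun _ => 0, fun _ _ => hk, fun i => (noCycle_singleton z).mono ?_⟩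
    rintro v ⟨⟨hv, hv0⟩, _⟩
    exact h0 v hv hv0
  obtain ⟨X, hX, hcrit⟩ := exists_crit hp
  have hroot : ∀ n, ∀ v ∈ R, lev v = n → n < p →
      ∃ w : G.Walk v z, ∀ x ∈ w.support, x ∈ {v | v ∈ R ∧ lev v < p} := by
    intro n
    induction n with
    | zero =>
      intro v hv hv0 hp
      have := h0 v hv hv0
      subst this
      refine ⟨Walk.nil, ?_⟩
      intro x hx
      simp at hx
      subst hx
      exact ⟨hv, by omega⟩
    | succ n ih =>
      intro v hv hvn hp
      obtain ⟨u, hu, huv, hun⟩ := hpred v hv n hvn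
      obtain ⟨w, hw⟩ := ih u hu hun (by omega)
      refine ⟨Walk.cons huv w, ?_⟩
      intro x hx
      rw [Walk.support_cons, List.mem_cons] at hx
      rcases hx with rfl | hx
      · exact ⟨hv, by omega⟩
      · exact hw x hx
  refine ⟨{v | v ∈ R ∧ lev v < p}, X, fun v hv => hv.1, fun v hv => (hX hv).1, ?_,
    ⟨hz, by omega⟩, ?_, ?_, hcrit⟩
  · rw [Set.disjoint_left]
    intro v hv hvX
    have h1 : lev v = p := (hX hvX).2
    have h2 : lev v < p := hv.2
    omega
  · intro a ha b hb
    obtain ⟨w, hw⟩ := hroot _ a ha.1 rfl ha.2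
    obtain ⟨w', hw'⟩ := hroot _ b hb.1 rfl hb.2
    apply exists_path_of_walk (w.append w'.reverse)
    intro x hx
    rw [Walk.mem_support_append_iff, Walk.support_reverse, List.mem_reverse] at hx
    rcases hx with hx | hx
    · exact hw x hx
    · exact hw' x hx
  · intro x hx
    have h1 : lev x = p := (hX hx).2
    obtain ⟨u, hu, hxu, hul⟩ := hpred x (hX hx).1 (p - 1) (by omega)
    exact ⟨u, ⟨hu, by omega⟩, hxu⟩

/-- A long path into a still complicated connected set. -/
lemma lengthen [Finite V] (m k : ℕ) : ∀ {R : Set V} {z : V}, Conn G R → z ∈ R →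
    ¬ Col G γ A (m + k) R → ∃ R' : Set V, R' ⊆ R ∧ Conn G R' ∧ ¬ Col G γ A k R' ∧
      ∃ y ∈ R', ∃ a, Reach G γ ((R \ R') ∪ {y}) z y a m := by
  induction m with
  | zero =>
    intro R z hR hz h
    refine ⟨R, subset_rfl, hR, by simpa using h, z, hz, 0, Reach.refl (by simp)⟩
  | succ m ih =>
    intro R z hR hz h
    have h1 : ¬ Col G γ A (m + k) (R \ {z}) := by
      intro hc
      apply h
      have := hc.insert
      rw [show m + 1 + k = m + k + 1 by ring]
      exact this
    obtain ⟨X, hX, hcrit⟩ := exists_crit h1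
    obtain ⟨x, hx⟩ := hcrit.nonempty
    obtain ⟨p, _, hp⟩ := hR z hz x (hX hx).1
    obtain ⟨y, hy, q, hq⟩ := first_hit p hp hx
    obtain ⟨q, hqp, hq⟩ := exists_path_of_walk q hq
    have hzy : z ≠ y := by
      rintro rfl
      exact (hX hy).2 rfl
    have hql : 1 ≤ q.length := by
      rcases Nat.eq_zero_or_pos q.length with h | h
      · exact (hzy (Walk.eq_of_length_eq_zero h)).elim
      · exact h
    obtain ⟨R', hR', hR'c, hR'k, y', hy', a, ha⟩ := ih hcrit.conn hy hcrit.1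
    have hq' : Reach G γ ((R \ X) ∪ {y}) z y (walkVal γ q) 1 := ⟨q, hqp, hq, rfl, hql⟩
    have := hq'.append ha (by
      rintro v (hv | hv) hv'
      · rcases hv' with hv' | hv'
        · exact (hv.2 hv'.1).elim
        · have : v = y' := hv'
          subst this
          exact (hv.2 (hR' hy')).elim
      · exact hv)
    refine ⟨R', fun v hv => (hX (hR' hv)).1, hR'c, hR'k, y', hy', _, this.mono ?_ (by omega)⟩
    rintro v ((hv | hv) | (hv | hv))
    · exact Or.inl ⟨hv.1, fun h => hv.2 (hR' h)⟩
    · have : v = y := hv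
      subst this
      by_cases hvR : v ∈ R'
      · right
        obtain ⟨p, hp, hps, _⟩ := ha
        rcases hps v p.start_mem_support with h | h
        · exact (h.2 hvR).elim
        · exact h
      · exact Or.inl ⟨(hX hy).1, hvR⟩
    · exact Or.inl ⟨(hX hv.1).1, hv.2⟩
    · exact Or.inr hv

/-- Stabilizer of a set under translation. -/
def stab (S : Set Γ) : AddSubgroup Γ where
  carrier := {h | ∀ s, h + s ∈ S ↔ s ∈ S}
  zero_mem' := by intro s; simp
  add_mem' := by
    intro a b ha hb s
    rw [add_assoc, ha, hb]
  neg_mem' := by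
    intro a ha s
    have := ha (-a + s)
    rw [add_neg_cancel_left] at this
    exact this.symm

lemma mem_stab {S : Set Γ} {h : Γ} : h ∈ stab S ↔ ∀ s, h + s ∈ S ↔ s ∈ S := Iff.rfl

open Classical in
lemma grow_card (S : Finset Γ) (a b : Γ) (h : a - b ∉ stab (S : Set Γ)) :
    S.card + 1 ≤ (S.image (· + a) ∪ S.image (· + b)).card := by
  have ca : (S.image (· + a)).card = S.card := Finset.card_image_of_injective _ (add_left_injective a)
  have cb : (S.image (· + b)).card = S.card := Finset.card_image_of_injective _ (add_left_injective b)
  by_contra hlt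
  have e1 : S.image (· + a) = S.image (· + a) ∪ S.image (· + b) :=
    Finset.eq_of_subset_of_card_le Finset.subset_union_left (by omega)
  have e2 : S.image (· + b) = S.image (· + a) ∪ S.image (· + b) :=
    Finset.eq_of_subset_of_card_le Finset.subset_union_right (by omega)
  have e : S.image (· + a) = S.image (· + b) := e1.trans e2.symm
  apply h
  intro s
  simp only [Finset.mem_coe]
  have k1 : a - b + s ∈ S ↔ (a + s) ∈ S.image (· + b) := by
    rw [Finset.mem_image]
    constructor
    · intro h; exact ⟨_, h, by abel⟩
    · rintro ⟨t, ht, h⟩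
      have : a - b + s = t := by rw [sub_add_eq_add_sub, ← h]; abel
      rwa [this]
  have k2 : s ∈ S ↔ (a + s) ∈ S.image (· + a) := by
    rw [Finset.mem_image]
    constructor
    · intro h; exact ⟨_, h, by abel⟩
    · rintro ⟨t, ht, h⟩
      have : s = t := by rw [add_comm] at h; exact (add_left_cancel h).symm
      rwa [this]
  rw [k1, k2, e]

/-- number of colours needed for `n` growth steps. -/
def gfun (N : ℕ) : ℕ → ℕ
  | 0 => N
  | n + 1 => 2 * (gfun N n + 1)

lemma le_gfun (N n : ℕ) : N ≤ gfun N n := by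
  induction n with
  | zero => exact le_rfl
  | succ n ih => simp only [gfun]; omega

lemma gfun_eq (N n : ℕ) : gfun N n + 2 = 2 ^ n * (N + 2) := by
  induction n with
  | zero => simp [gfun]
  | succ n ih => simp only [gfun, pow_succ]; linarith

lemma walk_pot {H : AddSubgroup Γ} {X : Set V} (π : V → Γ)
    (h : ∀ x ∈ X, ∀ y ∈ X, G.Adj x y → π x + γ s(x, y) - π y ∈ H) {x y : V} (w : G.Walk x y)
    (hw : ∀ v ∈ w.support, v ∈ X) : π x + walkVal γ w - π y ∈ H := by
  induction w with
  | nil => simp [walkVal_nil]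
  | @cons a b c hab p ih =>
    have hp : ∀ v ∈ p.support, v ∈ X := fun v hv => hw v (by simp [hv])
    have h1 := h a (hw a (by simp)) b (hp b p.start_mem_support) hab
    have := H.add_mem h1 (ih hp)
    rw [walkVal_cons]
    convert this using 1
    abel

lemma growth [Finite V] (N l : ℕ) (n : ℕ) : ∀ (R T : Set V) (z0 z : V) (S : Finset Γ),
    Conn G R → z ∈ R → ¬ Col G γ A (gfun N n) R → S.Nonempty →
    (∀ s ∈ S, Reach G γ T z0 z s l) → (∀ v ∈ T, v ∈ R → v = z) →
    ∃ y ∈ R, ∃ S' : Finset Γ, S'.Nonempty ∧ (∀ s ∈ S', Reach G γ (T ∪ R) z0 y s l) ∧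
      (S.card + n ≤ S'.card ∨ ∃ X ⊆ R, Conn G X ∧ ¬ Col G γ A N X ∧
        ∀ (v : V) (w : G.Walk v v), (∀ x ∈ w.support, x ∈ X) →
          walkVal γ w ∈ stab (S' : Set Γ)) := by
  classical
  induction n with
  | zero =>
    intro R T z0 z S hR hz hcol hS hreach hT
    exact ⟨z, hz, S, hS, fun s hs => (hreach s hs).mono Set.subset_union_left le_rfl, Or.inl le_rfl⟩
  | succ n ih =>
    intro R T z0 z S hR hz hcol hS hreach hT
    obtain ⟨U, X, hUR, hXR, hUX, hzU, hUc, hN, hcrit⟩ := halve hR hz (by omega) hcol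
    have hdis : ∀ t, t ∈ U → t ∈ X → False := fun t h1 h2 => Set.disjoint_left.mp hUX h1 h2
    have hπ : ∀ x, ∃ a, x ∈ X → Reach G γ (U ∪ {x}) z x a 0 := by
      intro x
      by_cases hx : x ∈ X
      · obtain ⟨u, hu, hxu⟩ := hN x hx
        obtain ⟨a, ha⟩ := hUc.reach (γ := γ) hzU hu
        refine ⟨_, fun _ => (ha.append (Reach.edge (T := {u, x}) hxu.symm (by simp) (by simp))
          ?_).mono ?_ (by omega)⟩
        · rintro v hv (h | h)
          · exact h
          · have h : v = x := h
            subst h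
            exact (hdis v hv hx).elim
        · rintro v (h | h | h)
          · exact Or.inl h
          · have h : v = u := h
            subst h
            exact Or.inl hu
          · exact Or.inr h
      · exact ⟨0, fun h => (hx h).elim⟩
    choose π hπ using hπ
    by_cases hall : ∀ x ∈ X, ∀ y ∈ X, G.Adj x y → π x + γ s(x, y) - π y ∈ stab (S : Set Γ)
    · refine ⟨z, hz, S, hS, fun s hs => (hreach s hs).mono Set.subset_union_left le_rfl,
        Or.inr ⟨X, hXR, hcrit.conn, ?_, ?_⟩⟩
      · intro hc
        exact hcrit.1 (hc.mono (by have := le_gfun N n; omega))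
      · intro v w hw
        have := walk_pot π hall w hw
        simpa using this
    · push Not at hall
      obtain ⟨x, hx, y, hy, hxy, hnot⟩ := hall
      have hyR : y ∈ X \ {x} := ⟨hy, hxy.ne'⟩
      have r1 : Reach G γ (U ∪ {x, y}) z y (π y) 0 := (hπ y hy).mono (by
        rintro v (h | h)
        · exact Or.inl h
        · exact Or.inr (Or.inr h)) le_rfl
      have r2 : Reach G γ (U ∪ {x, y}) z y (π x + γ s(x, y)) 0 := by
        refine ((hπ x hx).append (Reach.edge (T := {x, y}) hxy (by simp) (by simp)) ?_).mono ?_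
          (by omega)
        · rintro v (h | h) (h' | h')
          · exact h'
          · have h' : v = y := h'
            subst h'
            exact (hdis v h hy).elim
          · exact h
          · exact h
        · rintro v ((h | h) | h)
          · exact Or.inl h
          · exact Or.inr (Or.inl h)
          · exact Or.inr h
      have hTT : ∀ v ∈ T, v ∈ U ∪ {x, y} → v = z := by
        rintro v hv (h | h | h)
        · exact hT v hv (hUR h)
        · have h : v = x := h
          exact hT v hv (h ▸ hXR hx)
        · have h : v = y := h
          exact hT v hv (h ▸ hXR hy)
      obtain ⟨y', hy', S', hS'ne, hS', hres⟩ := ih (X \ {x}) (T ∪ (U ∪ {x, y})) z0 y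
        (S.image (· + (π x + γ s(x, y))) ∪ S.image (· + π y)) (hcrit.conn_diff x hx) hyR
        (fun hc => hcrit.1 hc.insert) ((hS.image _).mono Finset.subset_union_left) (by
          intro s hs
          rw [Finset.mem_union, Finset.mem_image, Finset.mem_image] at hs
          rcases hs with ⟨t, ht, rfl⟩ | ⟨t, ht, rfl⟩
          · exact (hreach t ht).append r2 hTT
          · exact (hreach t ht).append r1 hTT) (by
          rintro v (h | h | h | h) hv
          · have := hT v h (hXR hv.1)
            subst this
            exact (hdis v hzU hv.1).elim
          · exact (hdis v h hv.1).elim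
          · exact (hv.2 h).elim
          · exact h)
      have hsub : X \ {x} ⊆ R := fun v hv => hXR hv.1
      refine ⟨y', hsub hy', S', hS'ne, fun s hs => (hS' s hs).mono ?_ le_rfl, ?_⟩
      · rintro v ((h | h | h | h) | h)
        · exact Or.inl h
        · exact Or.inr (hUR h)
        · have h : v = x := h
          exact Or.inr (h ▸ hXR hx)
        · have h : v = y := h
          exact Or.inr (h ▸ hXR hy)
        · exact Or.inr (hsub h)
      · rcases hres with h | ⟨X', hX', h1, h2, h3⟩
        · left
          have := grow_card S _ _ hnot
          omega
        · exact Or.inr ⟨X', hX'.trans hsub, h1, h2, h3⟩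

/-- One phase. -/
lemma phase [Finite V] (N n d : ℕ) (hd : 1 ≤ d) (R : Set V) (hR : Conn G R)
    (hcol : ¬ Col G γ A (2 * (d + gfun N n)) R) :
    ∃ (c : Γ) (S : Finset Γ), S.Nonempty ∧
      (∀ s ∈ S, ∃ (v : V) (w : G.Walk v v), w.IsCycle ∧ (∀ x ∈ w.support, x ∈ R) ∧
        walkVal γ w = c + s ∧ d ≤ w.length) ∧
      (n + 1 ≤ S.card ∨ ∃ X ⊆ R, Conn G X ∧ ¬ Col G γ A N X ∧
        ∀ (v : V) (w : G.Walk v v), (∀ x ∈ w.support, x ∈ X) →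
          walkVal γ w ∈ stab (S : Set Γ)) := by
  classical
  have hne : R.Nonempty := by
    by_contra h
    rw [Set.not_nonempty_iff_eq_empty] at h
    exact hcol (h ▸ Col.empty _)
  obtain ⟨r, hr⟩ := hne
  obtain ⟨U, X, hUR, hXR, hUX, hrU, hUc, hN, hcrit⟩ := halve hR hr (by omega) hcol
  obtain ⟨z0, hz0⟩ := hcrit.nonempty
  obtain ⟨R', hR'X, hR'c, hR'col, z, hz, a, ha⟩ := lengthen d (gfun N n) hcrit.conn hz0 hcrit.1
  obtain ⟨y, hy, S, hSne, hS, hres⟩ := growth N d n R' _ z0 z {a} hR'c hz hR'col (by simp)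
    (fun s hs => by rw [Finset.mem_singleton] at hs; rw [hs]; exact ha) (by
      rintro v (h | h) hv
      · exact (h.2 hv).elim
      · exact h)
  have hzy : z0 ≠ y := by
    rintro rfl
    obtain ⟨s, hs⟩ := hSne
    obtain ⟨p, hp, _, _, hl⟩ := hS s hs
    have := Walk.isPath_iff_nil.mp hp
    have h2 : p = Walk.nil := by simpa using this
    rw [h2] at hl
    simp at hl
    omega
  obtain ⟨c, hc⟩ := close_cycle (γ := γ) hUX hUc hN hz0 (hR'X hy) hzy
  refine ⟨c, S, hSne, ?_, ?_⟩
  · intro s hs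
    obtain ⟨p, hp, hpT, hpv, hpl⟩ := hS s hs
    obtain ⟨w, hw, hwU, hwv, hwl⟩ := hc p hp (by
      intro v hv
      rcases hpT v hv with (h | h) | h
      · exact h.1
      · have h : v = z := h
        exact h ▸ hR'X hz
      · exact hR'X h)
    refine ⟨y, w, hw, ?_, by rw [hwv, hpv], hpl.trans hwl⟩
    intro v hv
    rcases hwU v hv with h | h
    · exact hUR h
    · exact hXR h
  · rcases hres with h | ⟨X', hX', h1, h2, h3⟩
    · left
      simp at h
      omega
    · exact Or.inr ⟨X', hX'.trans (hR'X.trans hXR), h1, h2, h3⟩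

end Levels

section Final

variable {V : Type u} {Γ : Type v} [AddCommGroup Γ] {G : SimpleGraph V} {γ : Sym2 V → Γ}
  {A : Set Γ}

lemma exists_A_cycle {k : ℕ} (hk : 1 ≤ k) {R : Set V} (h : ¬ Col G γ A k R) :
    ∃ (v : V) (w : G.Walk v v), w.IsCycle ∧ (∀ x ∈ w.support, x ∈ R) ∧ walkVal γ w ∈ A := by
  by_contra hc
  push Not at hc
  apply h
  exact ⟨fun _ => 0, fun _ _ => hk, fun i v w hw hS => hc v w hw (fun x hx => (hS x hx).1)⟩

lemma arith_step (d k : ℕ) (hk : 1 ≤ k) :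
    2 * (d + gfun (2 ^ d * 8 ^ (k / 2)) (k - 1)) ≤ 2 ^ d * 8 ^ k := by
  have hg := gfun_eq (2 ^ d * 8 ^ (k / 2)) (k - 1)
  have hD : d + 1 ≤ 2 ^ d := Nat.lt_two_pow_self
  set g := gfun (2 ^ d * 8 ^ (k / 2)) (k - 1)
  have h8 : ∀ m : ℕ, 8 ^ m = (2 ^ m) ^ 3 := by
    intro m; rw [← pow_mul, mul_comm, pow_mul]; norm_num
  generalize 2 ^ d = D at *
  obtain ⟨m, hm⟩ : ∃ m, m = k / 2 := ⟨_, rfl⟩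
  have ht : 1 ≤ 2 ^ m := Nat.one_le_two_pow
  have h1 : 2 * g + 4 = 2 ^ k * (D * 8 ^ m + 2) := by
    have : 2 ^ k = 2 * 2 ^ (k - 1) := by rw [← pow_succ']; congr 1; omega
    rw [this, hm]
    linarith
  rw [h8] at h1 ⊢
  rcases Nat.even_or_odd' k with ⟨j, hj | hj⟩
  · have : m = j := by omega
    subst this
    have ht2 : 2 ≤ 2 ^ m := by
      calc 2 = 2 ^ 1 := rfl
        _ ≤ 2 ^ m := Nat.pow_le_pow_right (by norm_num) (by omega)
    have e : 2 ^ k = (2 ^ m) ^ 2 := by rw [hj, ← pow_mul, mul_comm]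
    rw [e] at h1 ⊢
    generalize 2 ^ m = t at *
    have a1 : t ^ 2 * 8 ≤ t ^ 5 := by
      calc t ^ 2 * 8 ≤ t ^ 2 * t ^ 3 := Nat.mul_le_mul_left _ (by
            calc 8 = 2 ^ 3 := rfl
              _ ≤ t ^ 3 := Nat.pow_le_pow_left ht2 3)
        _ = t ^ 5 := by ring
    have a2 : t ^ 5 * 2 ≤ t ^ 6 := by
      calc t ^ 5 * 2 ≤ t ^ 5 * t := Nat.mul_le_mul_left _ ht2
        _ = t ^ 6 := by ring
    have a3 : 1 ≤ t ^ 2 := Nat.one_le_pow _ _ ht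
    have a4 : D * (t ^ 5 * 2) ≤ D * t ^ 6 := Nat.mul_le_mul_left _ a2
    have a5 : D * (t ^ 2 * 8) ≤ D * t ^ 5 := Nat.mul_le_mul_left _ a1
    have a6 : 1 * t ^ 2 ≤ D * t ^ 2 := Nat.mul_le_mul_right _ (by omega)
    have a7 : D * 1 ≤ D * t ^ 2 := Nat.mul_le_mul_left _ a3
    nlinarith
  · have : m = j := by omega
    subst this
    have e : 2 ^ k = 2 * (2 ^ m) ^ 2 := by rw [hj, pow_succ, ← pow_mul, mul_comm m 2]; ring
    rw [e] at h1 ⊢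
    generalize 2 ^ m = t at *
    have a2 : t ^ 5 * 1 ≤ t ^ 6 := by
      calc t ^ 5 * 1 ≤ t ^ 5 * t := Nat.mul_le_mul_left _ ht
        _ = t ^ 6 := by ring
    have a1 : t ^ 2 * 1 ≤ t ^ 5 := by
      calc t ^ 2 * 1 ≤ t ^ 2 * t ^ 3 := Nat.mul_le_mul_left _ (Nat.one_le_pow _ _ ht)
        _ = t ^ 5 := by ring
    have a3 : 1 ≤ t ^ 2 := Nat.one_le_pow _ _ ht
    have a4 : D * (t ^ 5 * 1) ≤ D * t ^ 6 := Nat.mul_le_mul_left _ a2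
    have a5 : D * (t ^ 2 * 1) ≤ D * t ^ 5 := Nat.mul_le_mul_left _ a1
    have a6 : 1 * t ^ 2 ≤ D * t ^ 2 := Nat.mul_le_mul_right _ (by omega)
    have a7 : D * 1 ≤ D * t ^ 2 := Nat.mul_le_mul_left _ a3
    nlinarith

lemma arith_main (ω d : ℕ) (hω : 1 ≤ ω) (hd : 4 ≤ d) :
    2 * (d + gfun (2 ^ d * 8 ^ ω) ω) < (ω + 2) * 2 ^ (d * (ω + 1) + 1) := by
  have hg := gfun_eq (2 ^ d * 8 ^ ω) ω
  have hD : d + 1 ≤ 2 ^ d := Nat.lt_two_pow_self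
  set g := gfun (2 ^ d * 8 ^ ω) ω
  have h1 : 3 * (2 * (2 ^ d * (2 ^ ω * 8 ^ ω))) ≤ (ω + 2) * 2 ^ (d * (ω + 1) + 1) := by
    apply Nat.mul_le_mul (by omega)
    rw [pow_succ, mul_add, pow_add, mul_one, ← mul_pow, mul_comm 2, mul_comm (2 ^ d)]
    apply Nat.mul_le_mul_right
    apply Nat.mul_le_mul_right
    rw [show 2 * 8 = 2 ^ 4 by norm_num, ← pow_mul]
    exact Nat.pow_le_pow_right (by norm_num) (Nat.mul_le_mul_right _ hd)
  refine lt_of_lt_of_le ?_ h1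
  have a1 : 1 ≤ 8 ^ ω := Nat.one_le_pow _ _ (by norm_num)
  have a2 : 1 ≤ 2 ^ ω := Nat.one_le_two_pow
  generalize 2 ^ d = D at *
  generalize 2 ^ ω = t at *
  generalize 8 ^ ω = q at *
  have b1 : t * 1 ≤ t * q := Nat.mul_le_mul_left _ a1
  have b2 : D * 1 ≤ D * (t * q) := Nat.mul_le_mul_left _ (by omega)
  have b3 : 1 * (t * q) ≤ D * (t * q) := Nat.mul_le_mul_right _ (by omega)
  nlinarith

lemma finish [Finite V] (d : ℕ) (hd : 1 ≤ d)
    (hno : ∀ (v : V) (w : G.Walk v v), w.IsCycle → d ≤ w.length → walkVal γ w ∉ A) (k : ℕ) :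
    ∀ (H : AddSubgroup Γ) (R : Set V), Finite H → Nat.card H ≤ k → Conn G R →
      ¬ Col G γ A (2 ^ d * 8 ^ k) R →
      (∀ (v : V) (w : G.Walk v v), (∀ x ∈ w.support, x ∈ R) → walkVal γ w ∈ H) → False := by
  classical
  induction k using Nat.strong_induction_on with
  | _ k ih =>
  intro H R hfin hcard hR hcol hH
  have hpos : 0 < Nat.card H := Nat.card_pos
  have hk : 1 ≤ k := by omega
  obtain ⟨c, S, ⟨s0, hs0⟩, hS, hres⟩ := phase (2 ^ d * 8 ^ (k / 2)) (k - 1) d hd R hR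
    (fun h => hcol (h.mono (arith_step d k hk)))
  have hSH : ∀ s ∈ S, c + s ∈ H := by
    intro s hs
    obtain ⟨v, w, hw, hwR, hwv, hwl⟩ := hS s hs
    exact hwv ▸ hH v w hwR
  have hfull : (∀ h ∈ H, h - c ∈ S) → False := by
    intro hf
    obtain ⟨v, w, hw, hwR, hwA⟩ := exists_A_cycle (Nat.one_le_iff_ne_zero.mpr (by positivity)) hcol
    obtain ⟨v', w', hw', _, hwv', hwl'⟩ := hS _ (hf _ (hH v w hwR))
    apply hno v' w' hw' hwl'
    rw [hwv', add_sub_cancel]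
    exact hwA
  rcases hres with hcardS | ⟨X, hXR, hXc, hXcol, hXs⟩
  · apply hfull
    have hsub : ((S.image (c + ·) : Finset Γ) : Set Γ) ⊆ (H : Set Γ) := by
      intro t ht
      rw [Finset.mem_coe, Finset.mem_image] at ht
      obtain ⟨s, hs, rfl⟩ := ht
      exact hSH s hs
    have hc : (S.image (c + ·)).card = S.card :=
      Finset.card_image_of_injective _ (add_right_injective c)
    have heq := Set.eq_of_subset_of_ncard_le hsub (by
      rw [Set.ncard_coe_finset, hc]
      have : (H : Set Γ).ncard = Nat.card H := rfl
      omega) (Set.toFinite _)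
    intro h hh
    have : h ∈ ((S.image (c + ·) : Finset Γ) : Set Γ) := by rw [heq]; exact hh
    rw [Finset.mem_coe, Finset.mem_image] at this
    obtain ⟨s, hs, rfl⟩ := this
    simpa using hs
  · have hle : stab (S : Set Γ) ≤ H := by
      intro h hh
      have h1 : h + s0 ∈ S := (hh s0).mpr hs0
      have h2 := H.sub_mem (hSH _ h1) (hSH _ hs0)
      convert h2 using 1
      abel
    by_cases heq : stab (S : Set Γ) = H
    · apply hfull
      intro h hh
      have h1 : h - (c + s0) ∈ stab (S : Set Γ) := heq ▸ H.sub_mem hh (hSH _ hs0)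
      have h2 : h - (c + s0) + s0 ∈ S := (h1 s0).mpr hs0
      have h3 : h - c = h - (c + s0) + s0 := by abel
      rw [h3]; exact h2
    · have hfin' : Finite (stab (S : Set Γ)) := Finite.of_injective _ (AddSubgroup.inclusion_injective hle)
      have hdvd := AddSubgroup.card_dvd_of_le hle
      have hne : Nat.card (stab (S : Set Γ)) ≠ Nat.card H := fun he =>
        heq (AddSubgroup.eq_of_le_of_card_ge hle he.ge)
      obtain ⟨q, hq⟩ := hdvd
      have hq2 : 2 ≤ q := by
        rcases q with _ | _ | q
        · omega
        · omega
        · omega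
      have hle2 : Nat.card (stab (S : Set Γ)) * 2 ≤ Nat.card H := by
        rw [hq]; exact Nat.mul_le_mul_left _ hq2
      exact ih (k / 2) (by omega) _ X hfin' (by omega) hXc hXcol hXs

end Final

theorem statement2 (ω d : ℕ) (hω : 0 < ω) (hd : 0 < d)
    (Γ : Type v) [AddCommGroup Γ] (A : Set Γ) (hA : A.Nonempty)
    (hcard : (Aᶜ : Set Γ).encard ≤ (ω : ℕ∞))
    (V : Type u) [Fintype V] (G : SimpleGraph V) (γ : Sym2 V → Γ)
    (harb : (ω + 2) * 2 ^ (d * (ω + 1) + 1) ≤ arb G γ A) :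
    ContainsADCycle G γ A d := by
  classical
  have hcol : ∀ k, k < (ω + 2) * 2 ^ (d * (ω + 1) + 1) → ¬ Col G γ A k (Set.univ : Set V) := by
    rintro k hk ⟨f, hf, hfc⟩
    have : arb G γ A ≤ k := by
      apply Nat.sInf_le
      refine ⟨fun v => ⟨f v, hf v trivial⟩, fun i => (hfc i).mono ?_⟩
      rintro v ⟨hv, hvi⟩
      exact ⟨hv, by rw [← hvi]⟩
    omega
  by_contra hcon
  have hno : ∀ (v : V) (w : G.Walk v v), w.IsCycle → d ≤ w.length → walkVal γ w ∉ A :=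
    fun v w hw hl hA => hcon ⟨v, w, hw, hA, hl⟩
  rcases Nat.lt_or_ge d 4 with hd4 | hd4
  · have h1 : 1 < (ω + 2) * 2 ^ (d * (ω + 1) + 1) :=
      calc 1 < ω + 2 := by omega
        _ ≤ _ := Nat.le_mul_of_pos_right _ (by positivity)
    obtain ⟨v, w, hw, _, hwA⟩ := exists_A_cycle le_rfl (hcol 1 h1)
    have := hw.three_le_length
    exact hno v w hw (by omega) hwA
  · obtain ⟨R, _, hR⟩ := exists_crit (hcol _ (arith_main ω d hω hd4))
    obtain ⟨c, S, ⟨s0, hs0⟩, hS, hres⟩ := phase (2 ^ d * 8 ^ ω) ω d hd R hR.conn hR.1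
    have hSc : S.card ≤ ω := by
      have hsub : ((S.image (c + ·) : Finset Γ) : Set Γ) ⊆ Aᶜ := by
        intro t ht
        rw [Finset.mem_coe, Finset.mem_image] at ht
        obtain ⟨s, hs, rfl⟩ := ht
        obtain ⟨v, w, hw, hwR, hwv, hwl⟩ := hS s hs
        exact hwv ▸ hno v w hw hwl
      have h1 := (Set.encard_le_encard hsub).trans hcard
      rw [Set.encard_coe_eq_coe_finsetCard,
        Finset.card_image_of_injective _ (add_right_injective c)] at h1
      exact_mod_cast h1
    rcases hres with h | ⟨X, hXR, hXc, hXcol, hXs⟩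
    · omega
    · let φ : stab (S : Set Γ) → S := fun h => ⟨h.1 + s0, (h.2 s0).mpr hs0⟩
      have hφ : Function.Injective φ := by
        intro a b hab
        have : a.1 + s0 = b.1 + s0 := congrArg Subtype.val hab
        exact Subtype.ext (add_right_cancel this)
      have hfin : Finite (stab (S : Set Γ)) := Finite.of_injective φ hφ
      have hc : Nat.card (stab (S : Set Γ)) ≤ ω := by
        have := Nat.card_le_card_of_injective φ hφ
        rw [Nat.card_eq_fintype_card (α := S), Fintype.card_coe] at this
        omega
      exact finish d hd hno ω _ X hfin hc hXc hXcol hXs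

end ArbPaper
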